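/- (Central speed estimate.) Let W > 0 and γ ≥ 0 be constants, and let Ω ⊂ ℝ²₊ be a nonempty open bounded set satisfying the Steiner symmetry condition such that Ω = {x ∈ ℝ²₊ : 𝒢[1_Ω](x) − W·x₂ − γ > 0}. Then (1/π)·∫_Ω y₂/(y₁² + y₂²) dy > 2W. (The left-hand side is the x₂-derivative at the origin of the odd extension of 𝒢[1_Ω] to ℝ²; thus the horizontal fluid speed at the center of the dipole exceeds twice the traveling speed.) -/

import Mathlib

open MeasureTheory Real Set NNReal Filter Topology

noncomputable section

/-- The upper half plane `ℝ²₊`. -/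
def H : Set (ℝ × ℝ) := {p | 0 < p.2}

/-- The half-plane Green function
`G(x,y) = (1/(4π)) log(1 + 4 x₂ y₂ / |x-y|²)` (Euclidean distance). -/
def G (x y : ℝ × ℝ) : ℝ :=
  (1 / (4 * π)) * Real.log (1 + 4 * x.2 * y.2 / ((x.1 - y.1) ^ 2 + (x.2 - y.2) ^ 2))

/-- The potential `𝒢[ω](x) = ∫_{ℝ²₊} G(x,y) ω(y) dy`. -/
def Gpot (ω : ℝ × ℝ → ℝ) (x : ℝ × ℝ) : ℝ := ∫ y in H, G x y * ω y

/-- The kinetic energy `E(ω) = (1/2) ∫∫ G(x,y) ω(x) ω(y) dy dx`. -/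
def energy (ω : ℝ × ℝ → ℝ) : ℝ :=
  (1 / 2) * ∫ x in H, ∫ y in H, G x y * ω x * ω y

/-- The `L¹(ℝ²₊)` norm (mass). -/
def norm1 (ω : ℝ × ℝ → ℝ) : ℝ := ∫ x in H, |ω x|

/-- The `L²(ℝ²₊)` norm. -/
def norm2 (ω : ℝ × ℝ → ℝ) : ℝ := (∫ x in H, ω x ^ 2) ^ ((1 : ℝ) / 2)

/-- The impulse `‖x₂ ω‖₁ = ∫_{ℝ²₊} x₂ |ω(x)| dx`. -/
def impulse (ω : ℝ × ℝ → ℝ) : ℝ := ∫ x in H, x.2 * |ω x|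

/-- `ω ∈ (L¹ ∩ L²)(ℝ²₊)`. -/
def MemL1L2 (ω : ℝ × ℝ → ℝ) : Prop :=
  Integrable ω (volume.restrict H) ∧ Integrable (fun x => ω x ^ 2) (volume.restrict H)

/-- Finiteness of the impulse `‖x₂ ω‖₁ < ∞`. -/
def ImpulseFinite (ω : ℝ × ℝ → ℝ) : Prop :=
  Integrable (fun x : ℝ × ℝ => x.2 * |ω x|) (volume.restrict H)

/-- The admissible class `K_M`: patches `ω = 1_A` a.e. on `ℝ²₊` with
impulse `∫_A x₂ = M` and mass `|A| ≤ 1`. -/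
def memK (M : ℝ) (ω : ℝ × ℝ → ℝ) : Prop :=
  Integrable ω (volume.restrict H) ∧
  ∃ A : Set (ℝ × ℝ), A ⊆ H ∧ MeasurableSet A ∧
    (∀ᵐ x ∂volume.restrict H, ω x = A.indicator (fun _ => (1 : ℝ)) x) ∧
    (∫ x in A, x.2) = M ∧ volume A ≤ 1

/-- The admissible class `K_{M,∞}`: patches `ω = 1_A` a.e. on `ℝ²₊` with
impulse `∫_A x₂ = M`, without any mass bound. -/
def memKinf (M : ℝ) (ω : ℝ × ℝ → ℝ) : Prop :=
  Integrable ω (volume.restrict H) ∧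
  ∃ A : Set (ℝ × ℝ), A ⊆ H ∧ MeasurableSet A ∧
    (∀ᵐ x ∂volume.restrict H, ω x = A.indicator (fun _ => (1 : ℝ)) x) ∧
    (∫ x in A, x.2) = M

/-- The relaxed admissible class `K̃_M`: measurable `0 ≤ ω ≤ 1` with
mass `≤ 1` and impulse `≤ M`. -/
def memKt (M : ℝ) (ω : ℝ × ℝ → ℝ) : Prop :=
  Integrable ω (volume.restrict H) ∧
  (∀ᵐ x ∂volume.restrict H, 0 ≤ ω x ∧ ω x ≤ 1) ∧
  norm1 ω ≤ 1 ∧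
  Integrable (fun x : ℝ × ℝ => x.2 * |ω x|) (volume.restrict H) ∧
  impulse ω ≤ M

/-- The set of maximizers `S_M` of the energy over `K_M`. -/
def memS (M : ℝ) (ω : ℝ × ℝ → ℝ) : Prop :=
  memK M ω ∧ ∀ ω' : ℝ × ℝ → ℝ, memK M ω' → energy ω' ≤ energy ω

/-- The maximal energy `I_M` over `K_M`. -/
def Isup (M : ℝ) : ℝ := sSup (energy '' {ω | memK M ω})

/-- The maximal energy `I_{1,∞}` over `K_{1,∞}`. -/
def IsupInf : ℝ := sSup (energy '' {ω | memKinf 1 ω})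

/-- The Steiner symmetry condition for a set `Ω ⊆ ℝ²₊`. -/
def SteinerSet (Ω : Set (ℝ × ℝ)) : Prop :=
  (∀ x₁ x₂ : ℝ, 0 < x₂ → (((x₁, x₂) : ℝ × ℝ) ∈ Ω ↔ ((-x₁, x₂) : ℝ × ℝ) ∈ Ω)) ∧
  (∀ x₂ : ℝ, 0 < x₂ → ∀ a b : ℝ, 0 ≤ a → a ≤ b →
    ((b, x₂) : ℝ × ℝ) ∈ Ω → ((a, x₂) : ℝ × ℝ) ∈ Ω)

/-- The Steiner symmetry condition for a nonnegative function on `ℝ²₊`. -/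
def SteinerFn (f : ℝ × ℝ → ℝ) : Prop :=
  (∀ x₁ x₂ : ℝ, 0 < x₂ → f (x₁, x₂) = f (-x₁, x₂)) ∧
  (∀ x₂ : ℝ, 0 < x₂ → ∀ a b : ℝ, 0 ≤ a → a ≤ b → f (b, x₂) ≤ f (a, x₂))



lemma log_one_add_le_two_mul_rpow {u : ℝ} (hu : 0 ≤ u) :
    log (1 + u) ≤ 2 * u ^ (3 / 4 : ℝ) := by
  have h1 : (1 + u) ^ (3 / 4 : ℝ) ≤ 1 + u ^ (3 / 4 : ℝ) := by
    simpa using rpow_add_le_add_rpow (p := 3 / 4) zero_le_one hu (by norm_num) (by norm_num)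
  have h2 : log ((1 + u) ^ (3 / 4 : ℝ)) ≤ (1 + u) ^ (3 / 4 : ℝ) - 1 :=
    log_le_sub_one_of_pos (by positivity)
  rw [log_rpow (by positivity)] at h2
  have h3 : 0 ≤ u ^ (3 / 4 : ℝ) := by positivity
  linarith

lemma inv_sqrt_le_one_add_rpow {q : ℝ} (hq : 0 ≤ q) : (√q)⁻¹ ≤ 1 + q ^ (-(3 / 4) : ℝ) := by
  rcases hq.eq_or_lt with rfl | hq
  · simp
  rw [Real.sqrt_eq_rpow, ← rpow_neg hq.le]
  rcases le_total q 1 with h | h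
  · have := rpow_le_rpow_of_exponent_ge hq h (show (-(3 / 4) : ℝ) ≤ -(1 / 2) by norm_num)
    linarith
  · have := rpow_le_one_of_one_le_of_nonpos h (show (-(1 / 2) : ℝ) ≤ 0 by norm_num)
    have : 0 ≤ q ^ (-(3 / 4) : ℝ) := by positivity
    linarith

/-- The square of the Euclidean norm on `ℝ × ℝ`. -/
def euclSq (z : ℝ × ℝ) : ℝ := z.1 ^ 2 + z.2 ^ 2

lemma euclSq_nonneg (z : ℝ × ℝ) : 0 ≤ euclSq z := by unfold euclSq; positivity

lemma euclSq_pos {z : ℝ × ℝ} (hz : z ≠ 0) : 0 < euclSq z := by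
  refine (euclSq_nonneg z).lt_of_ne' fun h => hz ?_
  unfold euclSq at h
  ext <;> simp <;> nlinarith [sq_nonneg z.1, sq_nonneg z.2]

@[fun_prop]
lemma measurable_euclSq : Measurable euclSq := by unfold euclSq; fun_prop

lemma norm_sq_le_euclSq (z : ℝ × ℝ) : ‖z‖ ^ 2 ≤ euclSq z := by
  unfold euclSq
  rw [Prod.norm_def, norm_eq_abs, norm_eq_abs]
  rcases max_choice |z.1| |z.2| with h | h <;> rw [h, sq_abs] <;> nlinarith [sq_nonneg z.1, sq_nonneg z.2]

/-- A locally integrable kernel dominating both `|z|⁻¹` and `|z| ^ (-3/2)`. -/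
def domKer (z : ℝ × ℝ) : ℝ := 1 + euclSq z ^ (-(3 / 4) : ℝ)

lemma domKer_nonneg (z : ℝ × ℝ) : 0 ≤ domKer z := by
  have := euclSq_nonneg z
  unfold domKer; positivity

@[fun_prop]
lemma measurable_domKer : Measurable domKer := by unfold domKer; fun_prop

lemma inv_sqrt_euclSq_le (z : ℝ × ℝ) : (√(euclSq z))⁻¹ ≤ domKer z :=
  inv_sqrt_le_one_add_rpow (euclSq_nonneg z)

lemma rpow_euclSq_le (z : ℝ × ℝ) : euclSq z ^ (-(3 / 4) : ℝ) ≤ domKer z := by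
  unfold domKer; linarith

lemma euclSq_neg (z : ℝ × ℝ) : euclSq (-z) = euclSq z := by simp [euclSq]

lemma exists_integral_domKer_le {Ω : Set (ℝ × ℝ)} (hfin : volume Ω ≠ ⊤) :
    ∃ C, 0 ≤ C ∧ ∀ x, IntegrableOn (fun y => domKer (x - y)) Ω ∧
      ∫ y in Ω, domKer (x - y) ≤ C := by
  set g : ℝ × ℝ → ℝ := (Metric.ball 0 1).indicator fun z => ‖z‖ ^ (-(3 / 2) : ℝ) with hg
  have hgint : Integrable g := by
    rw [hg, integrable_indicator_iff measurableSet_ball]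
    rw [integrableOn_fun_norm_addHaar volume (f := fun y => y ^ (-(3 / 2) : ℝ))]
    have : Module.finrank ℝ (ℝ × ℝ) = 2 := by simp
    rw [this]
    have h2 : IntegrableOn (fun y : ℝ => y ^ (-(1 / 2) : ℝ)) (Ioo 0 1) :=
      (intervalIntegral.integrableOn_Ioo_rpow_iff zero_lt_one).2 (by norm_num)
    refine h2.congr_fun (fun y hy => ?_) measurableSet_Ioo
    simp only [smul_eq_mul]
    rw [show (2 - 1 : ℕ) = 1 from rfl, pow_one]
    nth_rewrite 2 [← rpow_one y]
    rw [← rpow_add hy.1]; norm_num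
  have hg0 : ∀ z, 0 ≤ g z := fun z => indicator_nonneg (fun z _ => by positivity) z
  have hle : ∀ z, domKer z ≤ 2 + g z := by
    intro z
    unfold domKer
    by_cases hz : ‖z‖ < 1
    · have : g z = ‖z‖ ^ (-(3 / 2) : ℝ) := indicator_of_mem (by simpa using hz) _
      rw [this]
      rcases eq_or_ne z 0 with rfl | h0
      · simp [euclSq]
      have h1 : euclSq z ^ (-(3 / 4) : ℝ) ≤ (‖z‖ ^ 2) ^ (-(3 / 4) : ℝ) :=
        rpow_le_rpow_of_nonpos (by positivity) (norm_sq_le_euclSq z) (by norm_num)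
      rw [← Real.rpow_natCast, ← rpow_mul (norm_nonneg z)] at h1
      norm_num at h1 ⊢
      linarith
    · have h1 : 1 ≤ euclSq z := by nlinarith [norm_sq_le_euclSq z]
      have := rpow_le_one_of_one_le_of_nonpos h1 (show (-(3 / 4) : ℝ) ≤ 0 by norm_num)
      linarith [hg0 z]
  have hc : IntegrableOn (fun _ => (2 : ℝ)) Ω := integrableOn_const hfin
  have hgx : ∀ x, Integrable (fun y => g (x - y)) := fun x => hgint.comp_sub_left x
  refine ⟨(∫ _ in Ω, (2 : ℝ)) + ∫ z, g z, add_nonneg (by positivity) (integral_nonneg hg0), fun x => ?_⟩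
  have hi : IntegrableOn (fun y => domKer (x - y)) Ω := by
    refine (hc.add (hgx x).integrableOn).mono' (by fun_prop : Measurable _).aestronglyMeasurable (ae_of_all _ fun y => ?_)
    rw [norm_of_nonneg (domKer_nonneg _)]
    exact hle _
  refine ⟨hi, (integral_mono hi (hc.add (hgx x).integrableOn) fun y => hle _).trans ?_⟩
  rw [integral_add' hc (hgx x).integrableOn, ← integral_sub_left_eq_self g volume x]
  gcongr
  · exact ae_of_all _ fun y => hg0 _
  · exact hgx x
  · exact Measure.restrict_le_self

lemma arctan_sub_add_arctan_add_le {a : ℝ} (ha : 0 ≤ a) (b : ℝ) :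
    arctan (a - b) + arctan (a + b) ≤ 2 * arctan a := by
  wlog hb : 0 ≤ b generalizing b
  · have := this (-b) (by linarith)
    rwa [sub_neg_eq_add, ← sub_eq_add_neg, add_comm] at this
  have hd : ∀ x, HasDerivAt (fun x => arctan (a - x) + arctan (a + x))
      (1 / (1 + (a - x) ^ 2) * (-1) + 1 / (1 + (a + x) ^ 2) * 1) x := fun x =>
    ((hasDerivAt_id x).const_sub a).arctan.add ((hasDerivAt_id x).const_add a).arctan
  have h := antitoneOn_of_deriv_nonpos (convex_Ici (0 : ℝ))
    (fun x _ => (hd x).continuousAt.continuousWithinAt)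
    (fun x _ => (hd x).differentiableAt.differentiableWithinAt) (fun x hx => by
      rw [interior_Ici, mem_Ioi] at hx
      rw [(hd x).deriv]
      have : 1 / (1 + (a + x) ^ 2) ≤ 1 / (1 + (a - x) ^ 2) := by
        apply one_div_le_one_div_of_le (by positivity)
        nlinarith [mul_nonneg ha hx.le]
      linarith)
  have := h (self_mem_Ici) hb hb
  simp only [sub_zero, add_zero] at this
  linarith

lemma integral_poisson (x l : ℝ) {h : ℝ} (hh : 0 < h) :
    ∫ t in -l..l, h / ((x - t) ^ 2 + h ^ 2) =
      arctan (l / h - x / h) + arctan (l / h + x / h) := by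
  have hd : ∀ t, HasDerivAt (fun t => - arctan ((x - t) / h)) (h / ((x - t) ^ 2 + h ^ 2)) t := by
    intro t
    have := ((((hasDerivAt_id t).const_sub x).div_const h).arctan).neg
    refine this.congr_deriv ?_
    simp only [id]
    field_simp
    ring
  rw [intervalIntegral.integral_eq_sub_of_hasDerivAt (fun t _ => hd t)]
  · have h1 : (x - l) / h = -(l / h - x / h) := by ring
    have h2 : (x - -l) / h = l / h + x / h := by ring
    rw [h1, h2, arctan_neg]
    ring
  · refine (Continuous.div (by fun_prop) (by fun_prop) fun t => ?_).intervalIntegrable _ _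
    positivity

lemma exists_ae_eq_Ioc {S : Set ℝ} (hsymm : ∀ t, t ∈ S ↔ -t ∈ S)
    (hdown : ∀ a b, 0 ≤ a → a ≤ b → b ∈ S → a ∈ S) (hb : Bornology.IsBounded S)
    (hne : S.Nonempty) : ∃ l, 0 ≤ l ∧ S =ᵐ[volume] Ioc (-l) l := by
  have hbdd : BddAbove S := hb.bddAbove
  have habs : ∀ t ∈ S, |t| ∈ S := fun t ht => by
    rcases abs_choice t with h | h <;> rw [h]
    · exact ht
    · exact (hsymm t).1 ht
  have hle : ∀ t ∈ S, |t| ≤ sSup S := fun t ht => le_csSup hbdd (habs t ht)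
  have hl : 0 ≤ sSup S := by
    obtain ⟨t, ht⟩ := hne
    exact (abs_nonneg t).trans (hle t ht)
  have hsub : S ⊆ Icc (-sSup S) (sSup S) := fun t ht => abs_le.1 (hle t ht)
  have hsup : Ioo (-sSup S) (sSup S) ⊆ S := by
    intro t ht
    obtain ⟨b, hbS, hlt⟩ := exists_lt_of_lt_csSup hne (abs_lt.2 ht)
    have := hdown |t| b (abs_nonneg t) hlt.le hbS
    rcases abs_choice t with h | h <;> rw [h] at this
    · exact this
    · exact (hsymm t).2 this
  refine ⟨sSup S, hl, EventuallyLE.antisymm ?_ ?_⟩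
  · exact (LE.le.eventuallyLE hsub).trans Ioc_ae_eq_Icc.symm.le
  · exact Ioo_ae_eq_Ioc.symm.le.trans (LE.le.eventuallyLE hsup)

lemma setIntegral_poisson_le {S : Set ℝ} (hsymm : ∀ t, t ∈ S ↔ -t ∈ S)
    (hdown : ∀ a b, 0 ≤ a → a ≤ b → b ∈ S → a ∈ S) (hb : Bornology.IsBounded S)
    (x : ℝ) {h k : ℝ} (hk : 0 < k) (hkh : k ≤ h) :
    ∫ t in S, h / ((x - t) ^ 2 + h ^ 2) ≤ ∫ t in S, k / ((0 - t) ^ 2 + k ^ 2) := by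
  rcases S.eq_empty_or_nonempty with rfl | hne
  · simp
  obtain ⟨l, hl, hS⟩ := exists_ae_eq_Ioc hsymm hdown hb hne
  rw [setIntegral_congr_set hS, setIntegral_congr_set hS,
    ← intervalIntegral.integral_of_le (by linarith), ← intervalIntegral.integral_of_le (by linarith),
    integral_poisson _ _ (hk.trans_le hkh), integral_poisson _ _ hk, zero_div, sub_zero, add_zero,
    ← two_mul]
  have : l / h ≤ l / k := by gcongr
  have h2 := arctan_strictMono.monotone this
  linarith [arctan_sub_add_arctan_add_le (a := l / h) (by have := hk.trans_le hkh; positivity) (x / h)]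

lemma setIntegral_poisson_lt {S : Set ℝ} (hsymm : ∀ t, t ∈ S ↔ -t ∈ S)
    (hdown : ∀ a b, 0 ≤ a → a ≤ b → b ∈ S → a ∈ S) (hb : Bornology.IsBounded S)
    (hpos : 0 < volume S) {h k : ℝ} (hk : 0 < k) (hkh : k < h) :
    ∫ t in S, h / ((0 - t) ^ 2 + h ^ 2) < ∫ t in S, k / ((0 - t) ^ 2 + k ^ 2) := by
  obtain ⟨l, hl, hS⟩ := exists_ae_eq_Ioc hsymm hdown hb (nonempty_of_measure_ne_zero hpos.ne')
  have hl : 0 < l := by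
    rw [measure_congr hS, Real.volume_Ioc, ENNReal.ofReal_pos] at hpos
    linarith
  rw [setIntegral_congr_set hS, setIntegral_congr_set hS,
    ← intervalIntegral.integral_of_le (by linarith), ← intervalIntegral.integral_of_le (by linarith),
    integral_poisson _ _ (hk.trans hkh), integral_poisson _ _ hk]
  have : l / h < l / k := by gcongr
  have h2 := arctan_strictMono this
  simp only [zero_div, sub_zero, add_zero]
  linarith

/-- The kernel `(σ + y₂) / ((x₁ - y₁)² + (σ + y₂)²)`. -/
def poissonKer (x₁ σ : ℝ) (y : ℝ × ℝ) : ℝ := (σ + y.2) / ((x₁ - y.1) ^ 2 + (σ + y.2) ^ 2)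

@[fun_prop]
lemma measurable_poissonKer (x₁ σ : ℝ) : Measurable (poissonKer x₁ σ) := by
  unfold poissonKer; fun_prop

lemma div_euclSq_le (a : ℝ) {b : ℝ} (hb : 0 < b) : b / (a ^ 2 + b ^ 2) ≤ (√(a ^ 2 + b ^ 2))⁻¹ := by
  have hq : 0 < a ^ 2 + b ^ 2 := by positivity
  have hs : b ≤ √(a ^ 2 + b ^ 2) := Real.le_sqrt_of_sq_le (by nlinarith [sq_nonneg a])
  have h2 : √(a ^ 2 + b ^ 2) * √(a ^ 2 + b ^ 2) = a ^ 2 + b ^ 2 := Real.mul_self_sqrt hq.le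
  have h3 : 0 < √(a ^ 2 + b ^ 2) := Real.sqrt_pos.2 hq
  rw [div_le_iff₀ hq]
  nth_rewrite 2 [← h2]
  rw [inv_mul_cancel_left₀ h3.ne']
  exact hs

section Steiner

variable {Ω : Set (ℝ × ℝ)}

lemma integrableOn_poissonKer (hfin : volume Ω ≠ ⊤) (hm : MeasurableSet Ω) (hsub : Ω ⊆ H)
    (x₁ : ℝ) {σ : ℝ} (hσ : 0 ≤ σ) : IntegrableOn (poissonKer x₁ σ) Ω := by
  obtain ⟨C, -, hC⟩ := exists_integral_domKer_le hfin
  refine (hC (x₁, -σ)).1.mono' (by fun_prop : Measurable _).aestronglyMeasurable ?_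
  filter_upwards [ae_restrict_mem hm] with y hy
  have hy : 0 < y.2 := hsub hy
  have hb : 0 < σ + y.2 := by linarith
  rw [norm_of_nonneg (by unfold poissonKer; positivity)]
  refine (div_euclSq_le _ hb).trans ?_
  have hq : (x₁ - y.1) ^ 2 + (σ + y.2) ^ 2 = euclSq ((x₁, -σ) - y) := by
    simp only [euclSq, Prod.fst_sub, Prod.snd_sub]
    ring
  rw [hq]
  exact inv_sqrt_euclSq_le _

lemma setIntegral_eq_integral_slices (hm : MeasurableSet Ω) {g : ℝ × ℝ → ℝ}
    (hg : IntegrableOn g Ω) :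
    Integrable (fun s => ∫ t in {t | (t, s) ∈ Ω}, g (t, s)) ∧
    ∫ y in Ω, g y = ∫ s, ∫ t in {t | (t, s) ∈ Ω}, g (t, s) := by
  have hi : Integrable (Ω.indicator g) ((volume : Measure ℝ).prod volume) :=
    (integrable_indicator_iff hm).2 hg
  have heq : (fun s => ∫ t in {t | (t, s) ∈ Ω}, g (t, s)) =
      fun s => ∫ t, Ω.indicator g (t, s) := by
    ext s
    rw [← integral_indicator (by exact measurable_prodMk_right hm)]
    rfl
  rw [heq]
  refine ⟨hi.integral_prod_right, ?_⟩
  rw [← integral_indicator hm]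
  exact integral_prod_symm _ hi

lemma slice_symm (hsub : Ω ⊆ H) (hst : SteinerSet Ω) (s t : ℝ) :
    t ∈ {t | (t, s) ∈ Ω} ↔ -t ∈ {t | (t, s) ∈ Ω} := by
  by_cases hs : 0 < s
  · exact hst.1 t s hs
  · exact ⟨fun h => absurd (hsub h) hs, fun h => absurd (hsub h) hs⟩

lemma slice_down (hsub : Ω ⊆ H) (hst : SteinerSet Ω) (s a b : ℝ) (ha : 0 ≤ a) (hab : a ≤ b)
    (hb : b ∈ {t | (t, s) ∈ Ω}) : a ∈ {t | (t, s) ∈ Ω} :=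
  hst.2 s (hsub hb) a b ha hab hb

lemma slice_bounded (hbdd : Bornology.IsBounded Ω) (s : ℝ) :
    Bornology.IsBounded {t | (t, s) ∈ Ω} := by
  refine hbdd.image_fst.subset ?_
  rintro t ht
  exact ⟨(t, s), ht, rfl⟩

lemma setIntegral_poissonKer_le (hm : MeasurableSet Ω) (hbdd : Bornology.IsBounded Ω)
    (hsub : Ω ⊆ H) (hst : SteinerSet Ω) (x₁ : ℝ) {σ τ : ℝ} (hσ : 0 ≤ σ) (hστ : σ ≤ τ) :
    ∫ y in Ω, poissonKer x₁ τ y ≤ ∫ y in Ω, poissonKer 0 σ y := by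
  have hfin := (hbdd.measure_lt_top (μ := volume)).ne
  have h1 := setIntegral_eq_integral_slices hm
    (integrableOn_poissonKer hfin hm hsub x₁ (hσ.trans hστ))
  have h2 := setIntegral_eq_integral_slices hm (integrableOn_poissonKer hfin hm hsub 0 hσ)
  rw [h1.2, h2.2]
  refine integral_mono h1.1 h2.1 fun s => ?_
  by_cases hs : 0 < s
  · exact setIntegral_poisson_le (slice_symm hsub hst s) (slice_down hsub hst s)
      (slice_bounded hbdd s) x₁
      (h := τ + s) (k := σ + s) (by linarith) (by linarith)
  · have : {t | (t, s) ∈ Ω} = ∅ := eq_empty_of_forall_notMem fun t ht => hs (hsub ht)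
    simp [this]

lemma setIntegral_poissonKer_lt (hopen : IsOpen Ω) (hne : Ω.Nonempty)
    (hbdd : Bornology.IsBounded Ω) (hsub : Ω ⊆ H) (hst : SteinerSet Ω) {τ : ℝ} (hτ : 0 < τ) :
    ∫ y in Ω, poissonKer 0 τ y < ∫ y in Ω, poissonKer 0 0 y := by
  have hm := hopen.measurableSet
  have hfin := (hbdd.measure_lt_top (μ := volume)).ne
  have h1 := setIntegral_eq_integral_slices hm (integrableOn_poissonKer hfin hm hsub 0 hτ.le)
  have h2 := setIntegral_eq_integral_slices hm (integrableOn_poissonKer hfin hm hsub 0 le_rfl)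
  have hlt : ∀ s ∈ Prod.snd '' Ω, ∫ t in {t | (t, s) ∈ Ω}, poissonKer 0 τ (t, s) <
      ∫ t in {t | (t, s) ∈ Ω}, poissonKer 0 0 (t, s) := by
    rintro s ⟨⟨t, s⟩, hts, rfl⟩
    have hs : 0 < s := hsub hts
    have ho : IsOpen {t | (t, s) ∈ Ω} := hopen.preimage (by fun_prop : Continuous fun t => (t, s))
    exact setIntegral_poisson_lt (slice_symm hsub hst s) (slice_down hsub hst s)
      (slice_bounded hbdd s) (ho.measure_pos volume ⟨t, hts⟩)
      (h := τ + s) (k := 0 + s) (by linarith) (by linarith)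
  refine (setIntegral_poissonKer_le hm hbdd hsub hst 0 le_rfl hτ.le).lt_of_ne fun heq => ?_
  have hle : ∀ s, ∫ t in {t | (t, s) ∈ Ω}, poissonKer 0 τ (t, s) ≤
      ∫ t in {t | (t, s) ∈ Ω}, poissonKer 0 0 (t, s) := by
    intro s
    by_cases hs : s ∈ Prod.snd '' Ω
    · exact (hlt s hs).le
    · have : {t | (t, s) ∈ Ω} = ∅ := eq_empty_of_forall_notMem fun t ht => hs ⟨_, ht, rfl⟩
      simp [this]
  rw [h1.2, h2.2, integral_eq_iff_of_ae_le h1.1 h2.1 (ae_of_all _ hle)] at heq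
  have hpos := (isOpenMap_snd _ hopen).measure_pos volume (hne.image _)
  exact hpos.ne' (measure_mono_null (fun s hs => (hlt s hs).ne) heq)

end Steiner

/-- The logarithm of the Euclidean norm on `ℝ × ℝ`. -/
def logNorm (z : ℝ × ℝ) : ℝ := 1 / 2 * log (euclSq z)

@[fun_prop]
lemma measurable_logNorm : Measurable logNorm := by unfold logNorm; fun_prop

lemma logNorm_neg (z : ℝ × ℝ) : logNorm (-z) = logNorm z := by simp [logNorm, euclSq_neg]

lemma logNorm_sub_sub_le {z : ℝ × ℝ} {h : ℝ} (hz : z ≠ 0) (hzh : z - (0, h) ≠ 0) :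
    logNorm (z - (0, h)) - logNorm z ≤ |h| * domKer z := by
  have hA := euclSq_pos hzh
  have hB := euclSq_pos hz
  have hsA := Real.sqrt_pos.2 hA
  have hsB := Real.sqrt_pos.2 hB
  have h1 : √(euclSq (z - (0, h))) ≤ √(euclSq z) + |h| := by
    rw [Real.sqrt_le_left (by positivity)]
    have h2 : |z.2| ≤ √(euclSq z) := Real.abs_le_sqrt (by unfold euclSq; nlinarith [sq_nonneg z.1])
    have h3 : -(z.2 * h) ≤ |z.2| * |h| := by rw [← abs_mul]; exact neg_le_abs _
    have h4 : |z.2| * |h| ≤ √(euclSq z) * |h| := by gcongr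
    have h5 : √(euclSq z) ^ 2 = euclSq z := Real.sq_sqrt hB.le
    have h6 : |h| ^ 2 = h ^ 2 := sq_abs h
    have h7 : euclSq (z - (0, h)) = euclSq z - 2 * (z.2 * h) + h ^ 2 := by
      simp only [euclSq, Prod.fst_sub, Prod.snd_sub]; ring
    nlinarith
  have h2 := log_le_sub_one_of_pos (div_pos hsA hsB)
  rw [log_div hsA.ne' hsB.ne', log_sqrt hA.le, log_sqrt hB.le] at h2
  have h3 : √(euclSq (z - (0, h))) / √(euclSq z) ≤ 1 + |h| * (√(euclSq z))⁻¹ := by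
    rw [div_le_iff₀ hsB]
    field_simp
    exact h1
  have h4 : |h| * (√(euclSq z))⁻¹ ≤ |h| * domKer z := by
    gcongr
    exact inv_sqrt_euclSq_le z
  unfold logNorm
  linarith

lemma le_logNorm_sub_sub {z : ℝ × ℝ} {h : ℝ} (hz : z ≠ 0) (hzh : z - (0, h) ≠ 0) :
    -(|h| * domKer (z - (0, h))) ≤ logNorm (z - (0, h)) - logNorm z := by
  have he : z - (0, h) - (0, -h) = z := by ext <;> simp
  have := logNorm_sub_sub_le (z := z - (0, h)) (h := -h) hzh (by rwa [he])
  rw [he, abs_neg] at this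
  linarith

lemma logNorm_second_difference_le {z : ℝ × ℝ} {h : ℝ} (hh : 0 < h) (hz : z ≠ 0)
    (hm : z - (0, h) ≠ 0) (hp : z + (0, h) ≠ 0) :
    logNorm (z - (0, h)) - logNorm z + (logNorm (z + (0, h)) - logNorm z) ≤
      2 * h ^ (3 / 2 : ℝ) * domKer z := by
  have hA := euclSq_pos hm
  have hA' := euclSq_pos hp
  have hB := euclSq_pos hz
  have h1 : log (euclSq (z - (0, h)) * euclSq (z + (0, h))) ≤ log ((euclSq z + h ^ 2) ^ 2) := by
    apply log_le_log (mul_pos hA hA')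
    simp only [euclSq, Prod.fst_sub, Prod.snd_sub, Prod.fst_add, Prod.snd_add]
    nlinarith [sq_nonneg (z.2 * h)]
  have h2 : log (euclSq z + h ^ 2) - log (euclSq z) = log (1 + h ^ 2 / euclSq z) := by
    rw [← log_div (by positivity) hB.ne', add_div, div_self hB.ne']
  have h3 := log_one_add_le_two_mul_rpow (u := h ^ 2 / euclSq z) (by positivity)
  have h4 : (h ^ 2 / euclSq z) ^ (3 / 4 : ℝ) = h ^ (3 / 2 : ℝ) * euclSq z ^ (-(3 / 4) : ℝ) := by
    rw [div_rpow (by positivity) hB.le, rpow_neg hB.le, div_eq_mul_inv, ← Real.rpow_natCast,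
      ← rpow_mul hh.le]
    norm_num
  have h5 : h ^ (3 / 2 : ℝ) * euclSq z ^ (-(3 / 4) : ℝ) ≤ h ^ (3 / 2 : ℝ) * domKer z := by
    gcongr
    exact rpow_euclSq_le z
  rw [log_mul hA.ne' hA'.ne', log_pow] at h1
  push_cast at h1
  unfold logNorm
  linarith

lemma G_eq_logNorm {x y : ℝ × ℝ} (hx : 0 < x.2) (hy : 0 < y.2) (hxy : x - y ≠ 0) :
    2 * π * G x y = logNorm (x.1 - y.1, x.2 + y.2) - logNorm (x - y) := by
  have hB := euclSq_pos hxy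
  have hA : 0 < euclSq (x.1 - y.1, x.2 + y.2) := by
    apply euclSq_pos
    intro h
    have := congrArg Prod.snd h
    simp at this
    linarith
  unfold G logNorm
  have h1 : 1 + 4 * x.2 * y.2 / ((x.1 - y.1) ^ 2 + (x.2 - y.2) ^ 2) =
      euclSq (x.1 - y.1, x.2 + y.2) / euclSq (x - y) := by
    have hB' := hB
    simp only [euclSq, Prod.fst_sub, Prod.snd_sub] at hB' ⊢
    field_simp
    ring
  rw [h1, log_div hA.ne' hB.ne']
  have := Real.pi_pos
  field_simp
  ring

lemma G_nonneg {x y : ℝ × ℝ} (hx : 0 < x.2) (hy : 0 < y.2) : 0 ≤ G x y := by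
  unfold G
  refine mul_nonneg (by positivity) (log_nonneg ?_)
  have : 0 ≤ 4 * x.2 * y.2 / ((x.1 - y.1) ^ 2 + (x.2 - y.2) ^ 2) := by positivity
  linarith

lemma G_le {x y : ℝ × ℝ} (hx : 0 < x.2) (hy : 0 < y.2) {R : ℝ} (hR : y.2 ≤ R) :
    G x y ≤ (4 * R * x.2) ^ (3 / 4 : ℝ) * domKer (x - y) := by
  have hq := euclSq_nonneg (x - y)
  have heq : (x.1 - y.1) ^ 2 + (x.2 - y.2) ^ 2 = euclSq (x - y) := rfl
  unfold G
  rw [heq]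
  have h1 := log_one_add_le_two_mul_rpow (u := 4 * x.2 * y.2 / euclSq (x - y)) (by positivity)
  rw [div_rpow (by positivity) hq, div_eq_mul_inv _ (_ ^ _), ← rpow_neg hq] at h1
  have h2 : (4 * x.2 * y.2) ^ (3 / 4 : ℝ) * euclSq (x - y) ^ (-(3 / 4) : ℝ) ≤
      (4 * R * x.2) ^ (3 / 4 : ℝ) * domKer (x - y) := by
    have := domKer_nonneg (x - y)
    have h5 : 4 * x.2 * y.2 ≤ 4 * R * x.2 := by nlinarith
    exact mul_le_mul (rpow_le_rpow (by positivity) h5 (by norm_num)) (rpow_euclSq_le _)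
      (by positivity) (rpow_nonneg (by nlinarith) _)
  have h3 : 0 ≤ (4 * R * x.2) ^ (3 / 4 : ℝ) * domKer (x - y) :=
    mul_nonneg (rpow_nonneg (by nlinarith) _) (domKer_nonneg _)
  have h4 : 1 / (4 * π) ≤ 1 / 2 := by
    apply one_div_le_one_div_of_le <;> linarith [pi_gt_three]
  calc _ ≤ 1 / (4 * π) * (2 * ((4 * R * x.2) ^ (3 / 4 : ℝ) * domKer (x - y))) := by
        gcongr
        linarith
    _ ≤ 1 / 2 * (2 * ((4 * R * x.2) ^ (3 / 4 : ℝ) * domKer (x - y))) := by gcongr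
    _ = _ := by ring

section Steiner

variable {Ω : Set (ℝ × ℝ)}

lemma integrableOn_logNorm_reflected (hbdd : Bornology.IsBounded Ω) (hsub : Ω ⊆ H) (x₁ : ℝ)
    {σ : ℝ} (hσ : 0 < σ) : IntegrableOn (fun y => logNorm (x₁ - y.1, σ + y.2)) Ω := by
  have hc : IsCompact (closure Ω) := hbdd.isCompact_closure
  have hcl : closure Ω ⊆ {y | 0 ≤ y.2} :=
    closure_minimal (fun y hy => le_of_lt (show 0 < y.2 from hsub hy))
      (isClosed_le (by fun_prop) (by fun_prop))
  refine (ContinuousOn.integrableOn_compact hc ?_).mono_set subset_closure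
  unfold logNorm euclSq
  refine ContinuousOn.mul (by fun_prop) (ContinuousOn.log (by fun_prop) fun y hy => ?_)
  have : 0 ≤ y.2 := hcl hy
  positivity

lemma setIntegral_logNorm_sub_le (hm : MeasurableSet Ω) (hbdd : Bornology.IsBounded Ω)
    (hsub : Ω ⊆ H) (hst : SteinerSet Ω) (x₁ : ℝ) {σ τ : ℝ} (hσ : 0 < σ) (hστ : σ ≤ τ) :
    ∫ y in Ω, (logNorm (x₁ - y.1, τ + y.2) - logNorm (x₁ - y.1, σ + y.2)) ≤
      (∫ y in Ω, poissonKer 0 σ y) * (τ - σ) := by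
  have hfin := (hbdd.measure_lt_top (μ := volume)).ne
  have hd : ∀ s, 0 < s → HasDerivAt (fun s => ∫ y in Ω, logNorm (x₁ - y.1, s + y.2))
      (∫ y in Ω, poissonKer x₁ s y) s := by
    intro s hs
    refine (hasDerivAt_integral_of_dominated_loc_of_deriv_le (bound := fun _ => 2 / s)
      (μ := volume.restrict Ω) (F := fun s y => logNorm (x₁ - y.1, s + y.2)) (s := Ioi (s / 2)) (F' := fun s => poissonKer x₁ s) (Ioi_mem_nhds (by linarith)) ?_
      (integrableOn_logNorm_reflected hbdd hsub x₁ hs)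
      (by fun_prop : Measurable _).aestronglyMeasurable ?_ (integrableOn_const hfin) ?_).2
    · exact Eventually.of_forall fun t => (by fun_prop : Measurable _).aestronglyMeasurable
    · filter_upwards [ae_restrict_mem hm] with y hy t ht
      have hy : 0 < y.2 := hsub hy
      have ht : s / 2 < t := ht
      have hty : s / 2 < t + y.2 := by linarith
      have hty0 : 0 < t + y.2 := by linarith
      unfold poissonKer
      rw [norm_of_nonneg (by positivity), div_le_div_iff₀ (by positivity) hs]
      nlinarith [sq_nonneg (x₁ - y.1)]
    · filter_upwards [ae_restrict_mem hm] with y hy t ht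
      have hy : 0 < y.2 := hsub hy
      have ht : s / 2 < t := ht
      have hty0 : 0 < t + y.2 := by linarith
      have h1 : HasDerivAt (fun t : ℝ => (x₁ - y.1) ^ 2 + (t + y.2) ^ 2) (2 * (t + y.2)) t := by
        have := (((hasDerivAt_id t).add_const y.2).pow 2).const_add ((x₁ - y.1) ^ 2)
        refine this.congr_deriv ?_
        simp
      refine ((h1.log (by positivity)).const_mul (1 / 2)).congr_deriv ?_
      unfold poissonKer
      ring
  have hmv := (convex_Ici σ).image_sub_le_mul_sub_of_deriv_le
    (f := fun s => ∫ y in Ω, logNorm (x₁ - y.1, s + y.2)) (C := ∫ y in Ω, poissonKer 0 σ y)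
    (fun s hs => (hd s (hσ.trans_le hs)).continuousAt.continuousWithinAt)
    (fun s hs => (hd s (hσ.trans_le (interior_subset hs))).differentiableAt.differentiableWithinAt)
    (fun s hs => by
      have hs := interior_subset hs
      rw [(hd s (hσ.trans_le hs)).deriv]
      exact setIntegral_poissonKer_le hm hbdd hsub hst x₁ hσ.le hs)
    σ self_mem_Ici τ hστ hστ
  rwa [integral_sub (integrableOn_logNorm_reflected hbdd hsub x₁ (hσ.trans_le hστ))
    (integrableOn_logNorm_reflected hbdd hsub x₁ hσ)]

end Steiner

section Kernels

variable {Ω : Set (ℝ × ℝ)}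

lemma ae_prod_sub_ne (μ ν : Measure (ℝ × ℝ)) [SFinite ν] [NullSingletonClass ν] (c : ℝ × ℝ) :
    ∀ᵐ p ∂μ.prod ν, p.1 - p.2 ≠ c := by
  rw [ae_iff]
  simp only [not_not]
  rw [Measure.measure_prod_null (measurableSet_eq_fun (by fun_prop) (by fun_prop))]
  refine ae_of_all _ fun x => ?_
  have : (Prod.mk x ⁻¹' {a : (ℝ × ℝ) × (ℝ × ℝ) | a.1 - a.2 = c}) = {x - c} := by
    ext y
    simp only [mem_preimage, mem_ofPred_eq, mem_singleton_iff]
    exact ⟨fun h => by rw [← h]; abel, fun h => by rw [h]; abel⟩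
  simp [this]

/-- The difference quotient numerator `log |z - (0, h)| - log |z|`. -/
def logDiff (h : ℝ) (z : ℝ × ℝ) : ℝ := logNorm (z - (0, h)) - logNorm z

@[fun_prop]
lemma measurable_logDiff (h : ℝ) : Measurable (logDiff h) := by unfold logDiff; fun_prop

lemma norm_logDiff_le {z : ℝ × ℝ} {h : ℝ} (hh : 0 < h) (hz : z ≠ 0) (hzh : z ≠ (0, h)) :
    ‖logDiff h z‖ ≤ h * domKer z + h * domKer (z - (0, h)) := by
  have h1 := logNorm_sub_sub_le hz (sub_ne_zero.2 hzh)
  have h2 := le_logNorm_sub_sub hz (sub_ne_zero.2 hzh)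
  rw [abs_of_pos hh] at h1 h2
  have h3 := mul_nonneg hh.le (domKer_nonneg z)
  have h4 := mul_nonneg hh.le (domKer_nonneg (z - (0, h)))
  rw [norm_eq_abs, abs_le]
  constructor <;> unfold logDiff <;> linarith

lemma ae_sub_ne (x c : ℝ × ℝ) : ∀ᵐ y ∂volume.restrict Ω, x - y ≠ c := by
  have := Measure.ae_ne (volume.restrict Ω) (x - c)
  filter_upwards [this] with y hy h
  exact hy (by rw [← h]; abel)

lemma integrable_prod_domKer (hfin : volume Ω ≠ ⊤) (c : ℝ × ℝ) :
    Integrable (fun p : (ℝ × ℝ) × (ℝ × ℝ) => domKer (p.1 - p.2 - c))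
      ((volume.restrict Ω).prod (volume.restrict Ω)) := by
  have : IsFiniteMeasure (volume.restrict Ω) := isFiniteMeasure_restrict.2 hfin
  obtain ⟨C, -, hC⟩ := exists_integral_domKer_le hfin
  have hsub : ∀ x y : ℝ × ℝ, x - y - c = x - c - y := fun x y => by abel
  have hmeas : Measurable fun p : (ℝ × ℝ) × (ℝ × ℝ) => domKer (p.1 - p.2 - c) := by fun_prop
  rw [integrable_prod_iff hmeas.aestronglyMeasurable]
  simp only [hsub, norm_of_nonneg (domKer_nonneg _)]
  refine ⟨ae_of_all _ fun x => (hC (x - c)).1, ?_⟩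
  have hsm : StronglyMeasurable fun x : ℝ × ℝ => ∫ y in Ω, domKer (x - c - y) :=
    StronglyMeasurable.integral_prod_right
      (by fun_prop : Measurable fun p : (ℝ × ℝ) × (ℝ × ℝ) => domKer (p.1 - c - p.2)).stronglyMeasurable
  refine Integrable.of_bound hsm.aestronglyMeasurable C (ae_of_all _ fun x => ?_)
  rw [norm_of_nonneg (integral_nonneg fun y => domKer_nonneg _)]
  exact (hC (x - c)).2

lemma integrableOn_logDiff (hfin : volume Ω ≠ ⊤) {h : ℝ} (hh : 0 < h) (x : ℝ × ℝ) :
    IntegrableOn (fun y => logDiff h (x - y)) Ω := by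
  obtain ⟨C, -, hC⟩ := exists_integral_domKer_le hfin
  have hsub : ∀ y : ℝ × ℝ, x - y - (0, h) = x - (0, h) - y := fun y => by abel
  refine (((hC x).1.const_mul h).add ((hC (x - (0, h))).1.const_mul h)).mono'
    (by fun_prop : Measurable _).aestronglyMeasurable ?_
  filter_upwards [ae_sub_ne x 0, ae_sub_ne x (0, h)] with y h0 h1
  have := norm_logDiff_le hh h0 h1
  rwa [hsub] at this

lemma integrable_prod_logDiff (hfin : volume Ω ≠ ⊤) {h : ℝ} (hh : 0 < h) :
    Integrable (fun p : (ℝ × ℝ) × (ℝ × ℝ) => logDiff h (p.1 - p.2))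
      ((volume.restrict Ω).prod (volume.restrict Ω)) := by
  have h0 := integrable_prod_domKer hfin 0
  simp only [sub_zero] at h0
  refine ((h0.const_mul h).add ((integrable_prod_domKer hfin (0, h)).const_mul h)).mono'
    (by fun_prop : Measurable _).aestronglyMeasurable ?_
  filter_upwards [ae_prod_sub_ne _ _ 0, ae_prod_sub_ne _ _ (0, h)] with p h0 h1
  exact norm_logDiff_le hh h0 h1

lemma setIntegral_setIntegral_logDiff_le (hfin : volume Ω ≠ ⊤) {C : ℝ}
    (hC : ∀ x, ∫ y in Ω, domKer (x - y) ≤ C) {h : ℝ} (hh : 0 < h) :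
    ∫ x in Ω, ∫ y in Ω, logDiff h (x - y) ≤ h ^ (3 / 2 : ℝ) * (C * volume.real Ω) := by
  have : IsFiniteMeasure (volume.restrict Ω) := isFiniteMeasure_restrict.2 hfin
  have hI := integrable_prod_logDiff hfin hh
  have hK := integrable_prod_domKer hfin 0
  simp only [sub_zero] at hK
  have hI' : Integrable (fun p : (ℝ × ℝ) × (ℝ × ℝ) => logDiff h (p.2 - p.1))
      ((volume.restrict Ω).prod (volume.restrict Ω)) := hI.swap
  have hswap := integral_prod_swap (μ := volume.restrict Ω) (ν := volume.restrict Ω)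
    (fun p : (ℝ × ℝ) × (ℝ × ℝ) => logDiff h (p.1 - p.2))
  simp only [Prod.fst_swap, Prod.snd_swap] at hswap
  have hle := integral_mono_ae (hI.add hI') (hK.const_mul (2 * h ^ (3 / 2 : ℝ))) (by
    filter_upwards [ae_prod_sub_ne _ _ 0, ae_prod_sub_ne _ _ (0, h),
      ae_prod_sub_ne _ _ (-(0, h))] with p h0 h1 h2
    have := logNorm_second_difference_le hh h0 (sub_ne_zero.2 h1)
      (fun h3 => h2 (eq_neg_of_add_eq_zero_left h3))
    have he : logDiff h (p.2 - p.1) = logNorm (p.1 - p.2 + (0, h)) - logNorm (p.1 - p.2) := by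
      unfold logDiff
      rw [← logNorm_neg (p.2 - p.1 - (0, h)), ← logNorm_neg (p.2 - p.1)]
      congr 2 <;> abel
    simp only [Pi.add_apply]
    rw [he]
    exact this)
  rw [integral_add' hI hI', hswap, integral_const_mul, integral_prod _ hI, integral_prod _ hK] at hle
  have hKle : ∫ x in Ω, ∫ y in Ω, domKer (x - y) ≤ C * volume.real Ω := by
    have := integral_mono hK.integral_prod_left (integrable_const C) hC
    simpa [mul_comm] using this
  have : h ^ (3 / 2 : ℝ) * (∫ x in Ω, ∫ y in Ω, domKer (x - y)) ≤
      h ^ (3 / 2 : ℝ) * (C * volume.real Ω) := by gcongr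
  linarith

lemma le_setIntegral_logDiff (hfin : volume Ω ≠ ⊤) {C : ℝ}
    (hC : ∀ x, ∫ y in Ω, domKer (x - y) ≤ C) {h : ℝ} (hh : 0 < h) (x : ℝ × ℝ) :
    -(h * C) ≤ ∫ y in Ω, logDiff h (x - y) := by
  obtain ⟨_, -, hi⟩ := exists_integral_domKer_le hfin
  have hsub : ∀ y : ℝ × ℝ, x - y - (0, h) = x - (0, h) - y := fun y => by abel
  have hle := integral_mono_ae ((hi (x - (0, h))).1.const_mul (-h))
    (integrableOn_logDiff hfin hh x) (by
    filter_upwards [ae_sub_ne x 0, ae_sub_ne x (0, h)] with y h0 h1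
    have := le_logNorm_sub_sub h0 (sub_ne_zero.2 h1)
    rw [abs_of_pos hh, hsub] at this
    unfold logDiff
    rw [hsub]
    linarith)
  rw [integral_const_mul] at hle
  nlinarith [hC (x - (0, h))]

lemma Gpot_indicator (hm : MeasurableSet Ω) (hsub : Ω ⊆ H) (x : ℝ × ℝ) :
    Gpot (Ω.indicator fun _ => (1 : ℝ)) x = ∫ y in Ω, G x y := by
  unfold Gpot
  have : (fun y => G x y * Ω.indicator (fun _ => (1 : ℝ)) y) = Ω.indicator (G x) := by
    ext y
    by_cases hy : y ∈ Ω <;> simp [hy]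
  rw [this, setIntegral_indicator hm, inter_eq_right.2 hsub]

lemma measurable_G : Measurable (Function.uncurry G) := by
  unfold G Function.uncurry; fun_prop

lemma measurable_setIntegral_G : Measurable fun x => ∫ y in Ω, G x y :=
  (StronglyMeasurable.integral_prod_right measurable_G.stronglyMeasurable).measurable

lemma integrableOn_G (hm : MeasurableSet Ω) (hfin : volume Ω ≠ ⊤) (hsub : Ω ⊆ H) {R : ℝ}
    (hR : ∀ y ∈ Ω, y.2 ≤ R) {x : ℝ × ℝ} (hx : 0 < x.2) : IntegrableOn (G x) Ω := by
  obtain ⟨_, -, hi⟩ := exists_integral_domKer_le hfin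
  refine ((hi x).1.const_mul ((4 * R * x.2) ^ (3 / 4 : ℝ))).mono'
    (measurable_G.comp measurable_prodMk_left).aestronglyMeasurable ?_
  filter_upwards [ae_restrict_mem hm] with y hy
  rw [norm_of_nonneg (G_nonneg hx (hsub hy))]
  exact G_le hx (hsub hy) (hR y hy)

lemma setIntegral_G_le (hm : MeasurableSet Ω) (hfin : volume Ω ≠ ⊤) (hsub : Ω ⊆ H) {R C : ℝ}
    (hR0 : 0 ≤ R) (hR : ∀ y ∈ Ω, y.2 ≤ R) (hC : ∀ x, ∫ y in Ω, domKer (x - y) ≤ C)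
    {x : ℝ × ℝ} (hx : 0 < x.2) : ∫ y in Ω, G x y ≤ (4 * R * x.2) ^ (3 / 4 : ℝ) * C := by
  obtain ⟨_, -, hi⟩ := exists_integral_domKer_le hfin
  have hle := setIntegral_mono_on (integrableOn_G hm hfin hsub hR hx)
    ((hi x).1.const_mul ((4 * R * x.2) ^ (3 / 4 : ℝ))) hm
    (fun y hy => G_le hx (hsub hy) (hR y hy))
  rw [integral_const_mul] at hle
  refine hle.trans ?_
  gcongr
  exact hC x

lemma setIntegral_G_sub_le (hm : MeasurableSet Ω) (hbdd : Bornology.IsBounded Ω) (hsub : Ω ⊆ H)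
    (hst : SteinerSet Ω) {R : ℝ} (hR : ∀ y ∈ Ω, y.2 ≤ R) {h : ℝ} (hh : 0 < h) {x : ℝ × ℝ}
    (hx : h < x.2) :
    2 * π * ((∫ y in Ω, G x y) - ∫ y in Ω, G (x - (0, h)) y) ≤
      h * (∫ y in Ω, poissonKer 0 (x.2 - h) y) + ∫ y in Ω, logDiff h (x - y) := by
  have hfin := (hbdd.measure_lt_top (μ := volume)).ne
  have hx0 : 0 < x.2 := hh.trans hx
  have hxh : 0 < (x - (0, h)).2 := by simpa using hx
  have hD := integrableOn_logDiff hfin hh x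
  have h1 := integrableOn_logNorm_reflected hbdd hsub x.1 hx0
  have h2 := integrableOn_logNorm_reflected hbdd hsub x.1 (sub_pos.2 hx)
  have hP := setIntegral_logNorm_sub_le hm hbdd hsub hst x.1 (sub_pos.2 hx)
    (show x.2 - h ≤ x.2 by linarith)
  rw [← integral_sub (integrableOn_G hm hfin hsub hR hx0) (integrableOn_G hm hfin hsub hR hxh),
    ← integral_const_mul]
  have heq : ∫ y in Ω, 2 * π * (G x y - G (x - (0, h)) y) =
      ∫ y in Ω, ((logNorm (x.1 - y.1, x.2 + y.2) - logNorm (x.1 - y.1, x.2 - h + y.2)) +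
        logDiff h (x - y)) := by
    refine integral_congr_ae ?_
    filter_upwards [ae_restrict_mem hm, ae_sub_ne x 0, ae_sub_ne x (0, h)] with y hy hy0 hyh
    have hsub' : x - (0, h) - y = x - y - (0, h) := by abel
    have e1 := G_eq_logNorm hx0 (hsub hy) hy0
    have e2 := G_eq_logNorm hxh (hsub hy) (by rw [hsub']; exact sub_ne_zero.2 hyh)
    rw [hsub'] at e2
    simp only [Prod.fst_sub, Prod.snd_sub, sub_zero] at e2
    unfold logDiff
    linarith
  have h12 : IntegrableOn (fun y => logNorm (x.1 - y.1, x.2 + y.2) -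
      logNorm (x.1 - y.1, x.2 - h + y.2)) Ω := h1.sub h2
  rw [heq, integral_add h12 hD]
  linarith

end Kernels

section Patch

variable {Ω : Set (ℝ × ℝ)}

lemma volume_real_strip_le (hsub : Ω ⊆ H) {R : ℝ} (hR0 : 0 ≤ R)
    (hR : ∀ y ∈ Ω, |y.1| ≤ R) {h : ℝ} (hh : 0 ≤ h) :
    volume.real {x ∈ Ω | x.2 ≤ h} ≤ 2 * R * h := by
  have hs : {x ∈ Ω | x.2 ≤ h} ⊆ Icc (-R) R ×ˢ Icc 0 h := fun x hx =>
    ⟨abs_le.1 (hR x hx.1), le_of_lt (show 0 < x.2 from hsub hx.1), hx.2⟩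
  have hv : volume.real (Icc (-R) R ×ˢ Icc 0 h) = 2 * R * h := by
    rw [Measure.volume_eq_prod, measureReal_prod_prod, Real.volume_real_Icc_of_le (by linarith),
      Real.volume_real_Icc_of_le hh]
    ring
  rw [← hv]
  refine measureReal_mono hs ?_
  exact (isCompact_Icc.prod isCompact_Icc).measure_lt_top.ne

/-- Integrating the difference of the positive part of the stream function over a vertical
translation. -/
lemma setIntegral_sub_translate_nonneg {f : ℝ × ℝ → ℝ} (hm : MeasurableSet Ω)
    (hf : Integrable f) (hf0 : ∀ x, 0 ≤ f x) (hsupp : ∀ x ∉ Ω, f x = 0) (c : ℝ × ℝ) :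
    0 ≤ ∫ x in Ω, (f x - f (x - c)) := by
  have hfc : Integrable fun x => f (x - c) := hf.comp_sub_right c
  have h1 : ∫ x, (f x - f (x - c)) = 0 := by
    rw [integral_sub hf hfc, integral_sub_right_eq_self, sub_self]
  have hd : Integrable fun x => f x - f (x - c) := hf.sub hfc
  rw [← integral_add_compl hm hd] at h1
  have h2 : ∫ x in Ωᶜ, (f x - f (x - c)) ≤ 0 :=
    setIntegral_nonpos hm.compl fun x hx => by
      rw [hsupp x hx]
      linarith [hf0 (x - c)]
  linarith

/-- The translation inequality at step `h` for a traveling patch. -/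
lemma translation_inequality {W γ : ℝ} (hW : 0 < W) (hγ : 0 ≤ γ) (hopen : IsOpen Ω)
    (hbdd : Bornology.IsBounded Ω) (hsub : Ω ⊆ H) (hst : SteinerSet Ω)
    (hΩ : Ω = {x ∈ H | 0 < Gpot (Ω.indicator fun _ => (1 : ℝ)) x - W * x.2 - γ})
    {R C δ : ℝ} (hR0 : 0 ≤ R) (hR₁ : ∀ y ∈ Ω, |y.1| ≤ R) (hR₂ : ∀ y ∈ Ω, y.2 ≤ R) (hC0 : 0 ≤ C)
    (hC : ∀ x, ∫ y in Ω, domKer (x - y) ≤ C) {h : ℝ} (hh : 0 < h) (hhδ : h ≤ δ / 2) :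
    0 ≤ (h * ((∫ y in Ω, poissonKer 0 0 y) * volume.real Ω -
        ((∫ y in Ω, poissonKer 0 0 y) - ∫ y in Ω, poissonKer 0 (δ / 2) y) *
          volume.real {x ∈ Ω | δ < x.2}) + h ^ (3 / 2 : ℝ) * (C * volume.real Ω)) / (2 * π) -
      W * h * volume.real Ω +
      ((4 * R * h) ^ (3 / 4 : ℝ) * C + h * C / (2 * π) + W * h) * (2 * R * h) := by
  have hm := hopen.measurableSet
  have hfin := (hbdd.measure_lt_top (μ := volume)).ne
  have : IsFiniteMeasure (volume.restrict Ω) := isFiniteMeasure_restrict.2 hfin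
  have hπ := Real.pi_pos
  set K₀ := ∫ y in Ω, poissonKer 0 0 y with hK₀
  set K₁ := ∫ y in Ω, poissonKer 0 (δ / 2) y with hK₁
  set B := fun x => ∫ y in Ω, logDiff h (x - y) with hB
  set u := fun x => ∫ y in Ω, G x y with hu
  have hmu : Measurable u := measurable_setIntegral_G
  simp only [Gpot_indicator hm hsub] at hΩ
  have hΩiff : ∀ x, 0 < x.2 → (x ∈ Ω ↔ 0 < u x - W * x.2 - γ) := fun x hx =>
    ⟨fun hxΩ => by rw [hΩ] at hxΩ; exact hxΩ.2, fun h => by rw [hΩ]; exact ⟨hx, h⟩⟩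
  set f := Ω.indicator fun x => u x - W * x.2 - γ with hf
  have hfΩ : ∀ x ∈ Ω, f x = u x - W * x.2 - γ := fun x hx => indicator_of_mem hx _
  have hfn : ∀ x ∉ Ω, f x = 0 := fun x hx => indicator_of_notMem hx _
  have hf0 : ∀ x, 0 ≤ f x := fun x => by
    by_cases hx : x ∈ Ω
    · rw [hfΩ x hx]; exact ((hΩiff x (hsub hx)).1 hx).le
    · exact (hfn x hx).ge
  have hfge : ∀ x, 0 < x.2 → u x - W * x.2 - γ ≤ f x := fun x hx => by
    by_cases hxΩ : x ∈ Ω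
    · exact (hfΩ x hxΩ).ge
    · rw [hfn x hxΩ]; exact not_lt.1 fun h => hxΩ ((hΩiff x hx).2 h)
  have hfle : ∀ x ∈ Ω, f x ≤ (4 * R * x.2) ^ (3 / 4 : ℝ) * C := fun x hx => by
    have hx0 : 0 < x.2 := hsub hx
    have := setIntegral_G_le hm hfin hsub hR0 hR₂ hC hx0
    rw [hfΩ x hx]
    have : 0 < W * x.2 := mul_pos hW hx0
    linarith
  have hfint : Integrable f := by
    rw [hf, integrable_indicator_iff hm]
    refine Integrable.of_bound
      (by fun_prop : Measurable _).aestronglyMeasurable ((4 * R * R) ^ (3 / 4 : ℝ) * C) ?_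
    filter_upwards [ae_restrict_mem hm] with x hx
    have hx0 : 0 < x.2 := hsub hx
    rw [← hfΩ x hx, norm_of_nonneg (hf0 x)]
    refine (hfle x hx).trans ?_
    have := hR₂ x hx
    gcongr
  have hBint : Integrable B (volume.restrict Ω) :=
    (integrable_prod_logDiff hfin hh).integral_prod_left
  have hK : ∀ σ, 0 ≤ σ → ∫ y in Ω, poissonKer 0 σ y ≤ K₀ := fun σ hσ =>
    setIntegral_poissonKer_le hm hbdd hsub hst 0 le_rfl hσ
  have hK₁0 : 0 ≤ K₁ := setIntegral_nonneg hm fun y hy => by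
    have hy : 0 < y.2 := hsub hy
    have : 0 < δ / 2 + y.2 := by linarith
    unfold poissonKer
    positivity
  have hK₁₀ : K₁ ≤ K₀ := hK _ (by linarith)
  set T := {x ∈ Ω | x.2 ≤ h} with hT
  set S := {x ∈ Ω | δ < x.2} with hS
  have hTm : MeasurableSet T := hm.inter (measurableSet_le measurable_snd measurable_const)
  have hSm : MeasurableSet S := hm.inter (measurableSet_lt measurable_const measurable_snd)
  set e := (4 * R * h) ^ (3 / 4 : ℝ) * C + h * C / (2 * π) + W * h with he
  have he0 : 0 ≤ e := by positivity
  have hpt : ∀ x ∈ Ω, f x - f (x - (0, h)) ≤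
      (h * (K₀ - S.indicator (fun _ => K₀ - K₁) x) + B x) / (2 * π) - W * h +
        T.indicator (fun _ => e) x := by
    intro x hx
    have hx0 : 0 < x.2 := hsub hx
    have hBx : -(h * C) ≤ B x := le_setIntegral_logDiff hfin hC hh x
    by_cases hxh : x.2 ≤ h
    · rw [indicator_of_mem (show x ∈ T from ⟨hx, hxh⟩)]
      have h1 : 0 ≤ h * (K₀ - S.indicator (fun _ => K₀ - K₁) x) := by
        refine mul_nonneg hh.le ?_
        by_cases hxS : x ∈ S
        · rw [indicator_of_mem hxS]; linarith
        · rw [indicator_of_notMem hxS]; linarith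
      have h2 : -(h * C) / (2 * π) ≤
          (h * (K₀ - S.indicator (fun _ => K₀ - K₁) x) + B x) / (2 * π) := by
        gcongr; linarith
      have h3 : (4 * R * x.2) ^ (3 / 4 : ℝ) * C ≤ (4 * R * h) ^ (3 / 4 : ℝ) * C := by gcongr
      have h4 := hfle x hx
      have h5 := hf0 (x - (0, h))
      have h6 : -(h * C) / (2 * π) = -(h * C / (2 * π)) := neg_div _ _
      linarith
    · rw [indicator_of_notMem (show x ∉ T from fun h => hxh h.2)]
      have hxh : h < x.2 := not_le.1 hxh
      have h1 := setIntegral_G_sub_le hm hbdd hsub hst hR₂ hh hxh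
      have h2 := hfge (x - (0, h)) (by simpa using hxh)
      have h3 : ∫ y in Ω, poissonKer 0 (x.2 - h) y ≤ K₀ - S.indicator (fun _ => K₀ - K₁) x := by
        by_cases hxS : x ∈ S
        · rw [indicator_of_mem hxS, sub_sub_cancel]
          have : δ < x.2 := hxS.2
          exact setIntegral_poissonKer_le hm hbdd hsub hst 0 (by linarith) (by linarith)
        · rw [indicator_of_notMem hxS, sub_zero]
          exact hK _ (by linarith)
      have h4 : u x - u (x - (0, h)) ≤
          (h * (K₀ - S.indicator (fun _ => K₀ - K₁) x) + B x) / (2 * π) := by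
        rw [le_div_iff₀ (by positivity), mul_comm]
        refine h1.trans ?_
        gcongr
      rw [hfΩ x hx]
      simp only [Prod.snd_sub] at h2
      linarith
  have i1 : Integrable (S.indicator fun _ => K₀ - K₁) (volume.restrict Ω) :=
    (integrable_const _).indicator hSm
  have i2 : Integrable (T.indicator fun _ => e) (volume.restrict Ω) :=
    (integrable_const _).indicator hTm
  have i3 : Integrable (fun x => h * (K₀ - S.indicator (fun _ => K₀ - K₁) x)) (volume.restrict Ω) :=
    ((integrable_const _).sub i1).const_mul h
  have i4 : Integrable (fun x => (h * (K₀ - S.indicator (fun _ => K₀ - K₁) x) + B x) / (2 * π))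
    (volume.restrict Ω) := (i3.add hBint).div_const _
  have i5 : Integrable (fun x => (h * (K₀ - S.indicator (fun _ => K₀ - K₁) x) + B x) / (2 * π) -
    W * h) (volume.restrict Ω) := i4.sub (integrable_const _)
  have hcS : ∫ x in Ω, S.indicator (fun _ => K₀ - K₁) x = volume.real S * (K₀ - K₁) := by
    rw [setIntegral_indicator hSm, inter_eq_right.2 (sep_subset _ _), setIntegral_const,
      smul_eq_mul]
  have hcT : ∫ x in Ω, T.indicator (fun _ => e) x = volume.real T * e := by
    rw [setIntegral_indicator hTm, inter_eq_right.2 (sep_subset _ _), setIntegral_const,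
      smul_eq_mul]
  have h0 := setIntegral_sub_translate_nonneg hm hfint hf0 hfn (0, h)
  have h1 := setIntegral_mono_on (hfint.sub (hfint.comp_sub_right (0, h))).integrableOn
    (i5.add i2) hm hpt
  simp only [Pi.sub_apply, Pi.add_apply] at h1
  rw [integral_add i5 i2, integral_sub i4 (integrable_const _), integral_div,
    integral_add i3 hBint, integral_const_mul, integral_sub (integrable_const _) i1, hcS, hcT,
    setIntegral_const, setIntegral_const, smul_eq_mul, smul_eq_mul] at h1
  have hBle : ∫ x in Ω, B x ≤ h ^ (3 / 2 : ℝ) * (C * volume.real Ω) :=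
    setIntegral_setIntegral_logDiff_le hfin hC hh
  have hTle : volume.real T * e ≤ e * (2 * R * h) := by
    rw [mul_comm]
    gcongr
    exact volume_real_strip_le hsub hR0 hR₁ hh.le
  have h2 : (h * (volume.real Ω * K₀ - volume.real S * (K₀ - K₁)) + ∫ x in Ω, B x) / (2 * π) ≤
      (h * (K₀ * volume.real Ω - (K₀ - K₁) * volume.real S) +
        h ^ (3 / 2 : ℝ) * (C * volume.real Ω)) / (2 * π) := by
    refine div_le_div_of_nonneg_right ?_ (by positivity)
    rw [mul_comm (volume.real Ω) K₀, mul_comm (volume.real S)]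
    linarith
  linarith

end Patch

/-- central speed estimate: for a Steiner-symmetric traveling patch,
the horizontal fluid speed at the origin exceeds twice the traveling speed:
`(1/π) ∫_Ω y₂/(y₁² + y₂²) dy > 2W`. -/
theorem central_speed_estimate (W γ : ℝ) (hW : 0 < W) (hγ : 0 ≤ γ)
    (Ω : Set (ℝ × ℝ)) (hne : Ω.Nonempty) (hopen : IsOpen Ω)
    (hbdd : Bornology.IsBounded Ω) (hsub : Ω ⊆ H) (hst : SteinerSet Ω)
    (hΩ : Ω = {x ∈ H | 0 < Gpot (Ω.indicator fun _ => (1 : ℝ)) x - W * x.2 - γ}) :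
    2 * W < (1 / π) * ∫ y in Ω, y.2 / (y.1 ^ 2 + y.2 ^ 2) := by
  have hm := hopen.measurableSet
  have hfin := (hbdd.measure_lt_top (μ := volume)).ne
  have hπ := Real.pi_pos
  obtain ⟨R, hR⟩ := hbdd.exists_norm_le
  obtain ⟨x₀, hx₀⟩ := hne
  have hR0 : 0 ≤ R := (norm_nonneg _).trans (hR x₀ hx₀)
  have hR₁ : ∀ y ∈ Ω, |y.1| ≤ R := fun y hy => (norm_fst_le y).trans (hR y hy)
  have hR₂ : ∀ y ∈ Ω, y.2 ≤ R := fun y hy => (le_abs_self _).trans ((norm_snd_le y).trans (hR y hy))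
  obtain ⟨C, hC0, hC⟩ := exists_integral_domKer_le hfin
  have hx₀H : 0 < x₀.2 := hsub hx₀
  set δ := x₀.2 / 2 with hδ
  have hδ0 : 0 < δ := by positivity
  have hSo : IsOpen {x ∈ Ω | δ < x.2} := hopen.inter (isOpen_lt continuous_const continuous_snd)
  have hSpos : 0 < volume.real {x ∈ Ω | δ < x.2} :=
    ENNReal.toReal_pos (hSo.measure_pos volume ⟨x₀, hx₀, by linarith⟩).ne'
      (measure_ne_top_of_subset (sep_subset _ _) hfin)
  have hΩpos : 0 < volume.real Ω :=
    ENNReal.toReal_pos (hopen.measure_pos volume ⟨x₀, hx₀⟩).ne' hfin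
  have hlt := setIntegral_poissonKer_lt hopen ⟨x₀, hx₀⟩ hbdd hsub hst (half_pos hδ0)
  have hineq := fun h hh hhδ => translation_inequality hW hγ hopen hbdd hsub hst hΩ hR0 hR₁ hR₂ hC0
    (fun x => (hC x).2) (δ := δ) (h := h) hh hhδ
  set K₀ := ∫ y in Ω, poissonKer 0 0 y with hK₀
  set K₁ := ∫ y in Ω, poissonKer 0 (δ / 2) y with hK₁
  set m := volume.real Ω with hmΩ
  set s := volume.real {x ∈ Ω | δ < x.2} with hs
  set F : ℝ → ℝ := fun h => (K₀ * m - (K₀ - K₁) * s + h ^ (1 / 2 : ℝ) * (C * m)) / (2 * π) - W * m +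
    ((4 * R * h) ^ (3 / 4 : ℝ) * C + h * C / (2 * π) + W * h) * (2 * R) with hF
  have hFc : Continuous F := by
    have h1 : Continuous fun h : ℝ => h ^ (1 / 2 : ℝ) := Real.continuous_rpow_const (by norm_num)
    have h2 : Continuous fun h : ℝ => (4 * R * h) ^ (3 / 4 : ℝ) :=
      (Real.continuous_rpow_const (by norm_num)).comp (continuous_const_mul _)
    fun_prop
  have hF0 : 0 ≤ F 0 := by
    refine ge_of_tendsto (hFc.continuousWithinAt (s := Ioi 0)) ?_
    filter_upwards [Ioc_mem_nhdsGT (half_pos hδ0)] with h hh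
    have h1 := hineq h hh.1 hh.2
    have h2 : h ^ (3 / 2 : ℝ) = h * h ^ (1 / 2 : ℝ) := by
      rw [← rpow_one_add' hh.1.le (by norm_num)]
      norm_num
    rw [h2] at h1
    refine nonneg_of_mul_nonneg_right (b := F h) (h1.trans_eq ?_) hh.1
    simp only [hF]
    ring
  have hF0' : F 0 = (K₀ * m - (K₀ - K₁) * s) / (2 * π) - W * m := by
    simp [hF]
  have hK : 2 * π * (W * m) ≤ K₀ * m - (K₀ - K₁) * s := by
    rw [hF0', sub_nonneg, le_div_iff₀ (by positivity)] at hF0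
    linarith
  have hKW : 2 * π * W < K₀ := by
    have := mul_pos (sub_pos.2 hlt) hSpos
    exact lt_of_mul_lt_mul_right (by linarith) hΩpos.le
  have hKeq : ∫ y in Ω, y.2 / (y.1 ^ 2 + y.2 ^ 2) = K₀ := by
    simp [hK₀, poissonKer]
  rw [hKeq, one_div, inv_mul_eq_div, lt_div_iff₀ hπ]
  linarith
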